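/- Let R = [r] × [s] with labeling x, and let I = [i₁,i₂] × [j₁,j₂] be an interval of R such that (i₁ = 1 or j₂ = s) and (j₁ = 1 or i₂ = r). Then for every 0 ≤ k ≤ j₂ − j₁ + 1, W_{i₁+j₁+k−1, i₂+j₁}^{(j₂−j₁−k+1)}(x) = w_I^{(k)}(x) / w_I(x). -/

import Mathlib

namespace Paper

/-- Membership in the rectangle poset `R = [1,r] × [1,s]` (coordinates in `ℤ`). -/
def inR (r s : ℕ) (p : ℤ × ℤ) : Prop :=
  1 ≤ p.1 ∧ p.1 ≤ (r : ℤ) ∧ 1 ≤ p.2 ∧ p.2 ≤ (s : ℤ)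

instance (r s : ℕ) : DecidablePred (inR r s) := fun _ => by unfold inR; infer_instance

/-- The cover relation in the product of two chains. -/
def CoverStep (p q : ℤ × ℤ) : Prop :=
  (q.1 = p.1 + 1 ∧ q.2 = p.2) ∨ (q.1 = p.1 ∧ q.2 = p.2 + 1)

/-- Upper covers of `p` inside the rectangle. -/
def upSet (r s : ℕ) (p : ℤ × ℤ) : Finset (ℤ × ℤ) :=
  ({(p.1 + 1, p.2), (p.1, p.2 + 1)} : Finset (ℤ × ℤ)).filter (inR r s)

/-- Lower covers of `p` inside the rectangle. -/
def downSet (r s : ℕ) (p : ℤ × ℤ) : Finset (ℤ × ℤ) :=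
  ({(p.1 - 1, p.2), (p.1, p.2 - 1)} : Finset (ℤ × ℤ)).filter (inR r s)

/-- Sum of the labels of the lower covers of `p` (empty sum = 1). -/
noncomputable def dsum (r s : ℕ) (x : ℤ × ℤ → ℝ) (p : ℤ × ℤ) : ℝ :=
  if (downSet r s p).Nonempty then ∑ q ∈ downSet r s p, x q else 1

/-- Parallel sum of the labels of the upper covers of `p` (empty parallel sum = 1). -/
noncomputable def usum (r s : ℕ) (x : ℤ × ℤ → ℝ) (p : ℤ × ℤ) : ℝ :=
  if (upSet r s p).Nonempty then (∑ q ∈ upSet r s p, (x q)⁻¹)⁻¹ else 1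

/-- The birational toggle at `p`. -/
noncomputable def toggle (r s : ℕ) (p : ℤ × ℤ) (x : ℤ × ℤ → ℝ) : ℤ × ℤ → ℝ :=
  fun q => if q = p then usum r s x p * dsum r s x p / x p else x q

/-- The elements of `[1,a] × [1,b]` listed from top to bottom
(descending lexicographic order, the reverse of a linear extension). -/
def rectList (a b : ℕ) : List (ℤ × ℤ) :=
  (List.range a).reverse.flatMap fun i =>
    (List.range b).reverse.map fun j => ((i : ℤ) + 1, (j : ℤ) + 1)

/-- Birational rowmotion on the rectangle: toggles from top to bottom. -/
noncomputable def rho (r s : ℕ) (x : ℤ × ℤ → ℝ) : ℤ × ℤ → ℝ :=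
  (rectList r s).foldl (fun y p => toggle r s p y) x

/-- Inverse birational rowmotion: toggles from bottom to top. -/
noncomputable def rhoInv (r s : ℕ) (x : ℤ × ℤ → ℝ) : ℤ × ℤ → ℝ :=
  (rectList r s).reverse.foldl (fun y p => toggle r s p y) x

/-- Integer powers of birational rowmotion. -/
noncomputable def rhoPow (r s : ℕ) (k : ℤ) (x : ℤ × ℤ → ℝ) : ℤ × ℤ → ℝ :=
  if 0 ≤ k then (rho r s)^[k.toNat] x else (rhoInv r s)^[(-k).toNat] x

/-- Saturated chains from `a` to `b`, as lists of successive cover steps. -/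
def ChainList (a b : ℤ × ℤ) : Type :=
  {l : List (ℤ × ℤ) // l.Chain' CoverStep ∧ l.head? = some a ∧ l.getLast? = some b}

/-- The inverse birational transfer map on the rectangle: `φ⁻¹(x)_p` is the total weight
of all saturated chains from the minimal element `(1,1)` to `p`. -/
noncomputable def phiInv (x : ℤ × ℤ → ℝ) : ℤ × ℤ → ℝ :=
  fun p => ∑ᶠ c : ChainList (1, 1) p, (c.1.map x).prod

/-- The birational transfer map `φ(x)_p = x_p / ∑_{q ⋖ p} x_q`. -/
noncomputable def phi (r s : ℕ) (x : ℤ × ℤ → ℝ) : ℤ × ℤ → ℝ :=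
  fun p => x p / dsum r s x p

/-- A collection of `k` pairwise vertex-disjoint lattice paths in the interval
`[i₁,i₂] × [j₁,j₂]`, from `(i₁,j₁),…,(i₁,j₁+k-1)` to `(i₂,j₂-k+1),…,(i₂,j₂)`. -/
structure RSys (i₁ i₂ j₁ j₂ : ℤ) (k : ℕ) where
  path : Fin k → List (ℤ × ℤ)
  chain : ∀ t, (path t).Chain' CoverStep
  mem : ∀ t, ∀ v ∈ path t, i₁ ≤ v.1 ∧ v.1 ≤ i₂ ∧ j₁ ≤ v.2 ∧ v.2 ≤ j₂
  first : ∀ t : Fin k, (path t).head? = some (i₁, j₁ + ((t : ℕ) : ℤ))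
  final : ∀ t : Fin k, (path t).getLast? = some (i₂, j₂ - k + 1 + ((t : ℕ) : ℤ))
  disjoint : ∀ t t' : Fin k, t ≠ t' → ∀ v ∈ path t, v ∉ path t'

/-- The weight of a collection of paths: the product of labels of all its elements. -/
noncomputable def RSysWeight (x : ℤ × ℤ → ℝ) {i₁ i₂ j₁ j₂ : ℤ} {k : ℕ}
    (L : RSys i₁ i₂ j₁ j₂ k) : ℝ :=
  ∏ t : Fin k, ((L.path t).map x).prod

/-- `w_I^{(k)}(x)`: total weight of all collections of `k` nonintersecting paths in the
interval `I = [i₁,i₂] × [j₁,j₂]` (with `w_I^{(0)} = 1`). -/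
noncomputable def w (i₁ i₂ j₁ j₂ : ℤ) (k : ℤ) (x : ℤ × ℤ → ℝ) : ℝ :=
  if k ≤ 0 then 1 else ∑ᶠ L : RSys i₁ i₂ j₁ j₂ k.toNat, RSysWeight x L

/-- `w_I(x)`: the product of all labels in the interval `I = [i₁,i₂] × [j₁,j₂]`. -/
noncomputable def wProd (i₁ i₂ j₁ j₂ : ℤ) (x : ℤ × ℤ → ℝ) : ℝ :=
  ∏ p ∈ Finset.Icc i₁ i₂ ×ˢ Finset.Icc j₁ j₂, x p

/-- The directed edges of the graph `𝒢_R` on vertex set `[1,r+1] × [1,s]`: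
`(i,j) → (i+1,j)` for `(i,j) ∈ R`, and `(i,j) → (i+1,j-1)` when valid. -/
def GEdge (r s : ℕ) (p q : ℤ × ℤ) : Prop :=
  1 ≤ p.1 ∧ p.1 ≤ (r : ℤ) ∧ 1 ≤ p.2 ∧ p.2 ≤ (s : ℤ) ∧ q.1 = p.1 + 1 ∧
    (q.2 = p.2 ∨ (q.2 = p.2 - 1 ∧ 2 ≤ p.2))

/-- The weight of an edge of `𝒢_R`: `x_p⁻¹` for vertical edges, `1` for diagonal ones. -/
noncomputable def edgeWt (x : ℤ × ℤ → ℝ) (p q : ℤ × ℤ) : ℝ :=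
  if q.2 = p.2 then (x p)⁻¹ else 1

/-- The weight of a directed path in `𝒢_R`, given as its list of vertices. -/
noncomputable def listWt (x : ℤ × ℤ → ℝ) (l : List (ℤ × ℤ)) : ℝ :=
  ((l.zip l.tail).map fun e => edgeWt x e.1 e.2).prod

/-- The boundary vertex `P_t` of `𝒢_R`: `P_j = (1,j)` for `1 ≤ j ≤ s`, `P_{s+i} = (i+1,s)`. -/
def Pvert (s : ℕ) (t : ℤ) : ℤ × ℤ := if t ≤ (s : ℤ) then (1, t) else (t - s + 1, (s : ℤ))

/-- The boundary vertex `Q_t` of `𝒢_R`: `Q_i = (i,1)` for `1 ≤ i ≤ r`, `Q_{r+j} = (r+1,j)`. -/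
def Qvert (r : ℕ) (t : ℤ) : ℤ × ℤ := if t ≤ (r : ℤ) then (t, 1) else ((r : ℤ) + 1, t - r)

/-- A collection of `k` pairwise vertex-disjoint directed paths in `𝒢_R` from
`{P_i, …, P_{i+k-1}}` to `{Q_j, …, Q_{j+k-1}}`. -/
structure GSys (r s : ℕ) (i j : ℤ) (k : ℕ) where
  perm : Equiv.Perm (Fin k)
  path : Fin k → List (ℤ × ℤ)
  chain : ∀ t, (path t).Chain' (GEdge r s)
  first : ∀ t : Fin k, (path t).head? = some (Pvert s (i + ((t : ℕ) : ℤ)))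
  final : ∀ t : Fin k, (path t).getLast? = some (Qvert r (j + (((perm t) : ℕ) : ℤ)))
  disjoint : ∀ t t' : Fin k, t ≠ t' → ∀ v ∈ path t, v ∉ path t'

/-- The weight of a collection of paths in `𝒢_R`: the product of the weights of all
edges used. -/
noncomputable def GSysWeight (x : ℤ × ℤ → ℝ) {r s : ℕ} {i j : ℤ} {k : ℕ}
    (L : GSys r s i j k) : ℝ :=
  ∏ t : Fin k, listWt x (L.path t)

/-- `W_{ij}^{(k)}(x)`: total weight of all collections of `k` nonintersecting paths in
`𝒢_R` from `{P_i,…,P_{i+k-1}}` to `{Q_j,…,Q_{j+k-1}}`; `W_{ij}^{(0)} = 1`, and `0` when an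
out-of-range index occurs. -/
noncomputable def W (r s : ℕ) (x : ℤ × ℤ → ℝ) (i j k : ℤ) : ℝ :=
  if k < 0 then 0
  else if k = 0 then 1
  else if 1 ≤ i ∧ 1 ≤ j ∧ i + k - 1 ≤ (r : ℤ) + s ∧ j + k - 1 ≤ (r : ℤ) + s then
    ∑ᶠ L : GSys r s i j k.toNat, GSysWeight x L
  else 0

section Conjugation

/-- Interlacing row data of a system of `k` disjoint lattice paths: path `t` occupies the columns
`a t i, …, a t (i + 1)` in row `i`. -/
structure IsRowData (i₁ i₂ j₁ : ℤ) (k m : ℕ) (a : Fin k → ℤ → ℤ) : Prop where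
  left : ∀ t, a t i₁ = j₁ + (t : ℕ)
  right : ∀ t, a t (i₂ + 1) = j₁ + m + (t : ℕ)
  mono : ∀ t i, i₁ ≤ i → i ≤ i₂ → a t i ≤ a t (i + 1)
  sep : ∀ t t', t < t' → ∀ i, i₁ ≤ i → i ≤ i₂ → a t (i + 1) < a t' i

/-- Column data of a system of `m` disjoint paths of `𝒢_R` between rows `i₁` and `i₂ + 1`:
path `u` passes through the vertex `(i, c u i)`. -/
structure IsColData (i₁ i₂ j₁ : ℤ) (k m : ℕ) (c : Fin m → ℤ → ℤ) : Prop where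
  left : ∀ u, c u i₁ = j₁ + k + (u : ℕ)
  right : ∀ u, c u (i₂ + 1) = j₁ + (u : ℕ)
  step : ∀ u i, i₁ ≤ i → i ≤ i₂ → c u i - 1 ≤ c u (i + 1) ∧ c u (i + 1) ≤ c u i
  strict : ∀ u u', u < u' → ∀ i, i₁ ≤ i → i ≤ i₂ + 1 → c u i < c u' i

/-- In each row, the positions `a` and `c` correspond to conjugate partitions. -/
def Conj (i₁ i₂ j₁ : ℤ) {k m : ℕ} (a : Fin k → ℤ → ℤ) (c : Fin m → ℤ → ℤ) : Prop :=
  ∀ i, i₁ ≤ i → i ≤ i₂ + 1 → ∀ (t : Fin k) (u : Fin m),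
    a t i ≤ j₁ + (t : ℕ) + (u : ℕ) ↔ j₁ + (t : ℕ) + (u : ℕ) < c u i

lemma le_of_le_step {f : ℤ → ℤ} {p q : ℤ} (h : ∀ i, p ≤ i → i < q → f i ≤ f (i + 1))
    {i j : ℤ} (hi : p ≤ i) (hij : i ≤ j) (hj : j ≤ q) : f i ≤ f j := by
  induction j, hij using Int.leInduction with
  | base => exact le_rfl
  | succ n hn ih => exact (ih (by omega)).trans (h n (by omega) (by omega))

lemma ge_of_ge_step {f : ℤ → ℤ} {p q : ℤ} (h : ∀ i, p ≤ i → i < q → f (i + 1) ≤ f i)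
    {i j : ℤ} (hi : p ≤ i) (hij : i ≤ j) (hj : j ≤ q) : f j ≤ f i :=
  neg_le_neg_iff.1 (le_of_le_step (f := fun i => -f i)
    (fun i h₁ h₂ => neg_le_neg (h i h₁ h₂)) hi hij hj)

lemma sub_le_of_sub_one_le_step {f : ℤ → ℤ} {p q : ℤ}
    (h : ∀ i, p ≤ i → i < q → f i - 1 ≤ f (i + 1))
    {i j : ℤ} (hi : p ≤ i) (hij : i ≤ j) (hj : j ≤ q) : f i - (j - i) ≤ f j := by
  have := le_of_le_step (f := fun i => f i + i)
    (fun i h₁ h₂ => by have := h i h₁ h₂; omega) hi hij hj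
  omega

lemma add_sub_le_of_strictMono {n : ℕ} {g : Fin n → ℤ} (hg : ∀ t t', t < t' → g t < g t')
    {t t' : Fin n} (h : t ≤ t') : g t + ((t' : ℕ) - (t : ℕ) : ℤ) ≤ g t' := by
  obtain ⟨t', ht'⟩ := t'
  have h' : (t : ℕ) ≤ t' := h
  clear h
  induction t', h' using Nat.le_induction with
  | base => simp
  | succ d hd ih =>
    have h₁ := ih (by omega)
    have h₂ := hg ⟨d, by omega⟩ ⟨d + 1, ht'⟩ (by simp)
    simp only at h₁ ⊢
    push_cast
    omega

lemma exists_threshold {n : ℕ} {P : Fin n → Prop} (hP : ∀ u u', u ≤ u' → P u → P u') :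
    ∃ N : ℕ, N ≤ n ∧ ∀ u : Fin n, N ≤ (u : ℕ) ↔ P u := by
  classical
  have hex : ∃ N : ℕ, ∀ u : Fin n, N ≤ (u : ℕ) → P u := ⟨n, fun u hu => by omega⟩
  refine ⟨Nat.find hex, Nat.find_min' hex fun u hu => by omega, fun u =>
    ⟨Nat.find_spec hex u, fun hu => Nat.find_min' hex fun u' hu' => hP u u' hu' hu⟩⟩

variable {i₁ i₂ j₁ : ℤ} {k m : ℕ} {a a' : Fin k → ℤ → ℤ} {c c' : Fin m → ℤ → ℤ}

lemma IsRowData.bounds (ha : IsRowData i₁ i₂ j₁ k m a) (t : Fin k) {i : ℤ}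
    (h₁ : i₁ ≤ i) (h₂ : i ≤ i₂ + 1) :
    j₁ + (t : ℕ) ≤ a t i ∧ a t i ≤ j₁ + m + (t : ℕ) := by
  have hm : ∀ i, i₁ ≤ i → i < i₂ + 1 → a t i ≤ a t (i + 1) :=
    fun i h h' => ha.mono t i h (by omega)
  exact ⟨ha.left t ▸ le_of_le_step hm le_rfl h₁ h₂, ha.right t ▸ le_of_le_step hm h₁ h₂ le_rfl⟩

lemma IsRowData.strict (ha : IsRowData i₁ i₂ j₁ k m a) {i : ℤ}
    (h₁ : i₁ ≤ i) (h₂ : i ≤ i₂ + 1) (t t' : Fin k) (h : t < t') : a t i < a t' i := by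
  rcases h₂.lt_or_eq with h₂ | rfl
  · exact (ha.mono t i h₁ (by omega)).trans_lt (ha.sep t t' h i h₁ (by omega))
  · have h' : (t : ℕ) < t' := h
    rw [ha.right, ha.right]
    omega

lemma IsColData.bounds (hc : IsColData i₁ i₂ j₁ k m c) (u : Fin m) {i : ℤ}
    (h₁ : i₁ ≤ i) (h₂ : i ≤ i₂ + 1) :
    j₁ + (u : ℕ) ≤ c u i ∧ c u i ≤ j₁ + k + (u : ℕ) := by
  have hm : ∀ i, i₁ ≤ i → i < i₂ + 1 → c u (i + 1) ≤ c u i :=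
    fun i h h' => (hc.step u i h (by omega)).2
  exact ⟨hc.right u ▸ ge_of_ge_step hm h₁ h₂ le_rfl, hc.left u ▸ ge_of_ge_step hm le_rfl h₁ h₂⟩

lemma Conj.left_unique (ha : IsRowData i₁ i₂ j₁ k m a) (ha' : IsRowData i₁ i₂ j₁ k m a')
    (h : Conj i₁ i₂ j₁ a c) (h' : Conj i₁ i₂ j₁ a' c) (t : Fin k) {i : ℤ}
    (h₁ : i₁ ≤ i) (h₂ : i ≤ i₂ + 1) : a t i = a' t i := by
  have key : ∀ {a a' : Fin k → ℤ → ℤ}, IsRowData i₁ i₂ j₁ k m a → IsRowData i₁ i₂ j₁ k m a' →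
      Conj i₁ i₂ j₁ a c → Conj i₁ i₂ j₁ a' c → a t i ≤ a' t i := by
    intro a a' ha ha' h h'
    have b := ha.bounds t h₁ h₂
    have b' := ha'.bounds t h₁ h₂
    by_contra! hlt
    have e := h i h₁ h₂ t ⟨(a' t i - j₁ - (t : ℕ)).toNat, by omega⟩
    have e' := h' i h₁ h₂ t ⟨(a' t i - j₁ - (t : ℕ)).toNat, by omega⟩
    rw [← e'] at e
    simp only at e
    omega
  exact le_antisymm (key ha ha' h h') (key ha' ha h' h)

lemma Conj.right_unique (hc : IsColData i₁ i₂ j₁ k m c) (hc' : IsColData i₁ i₂ j₁ k m c')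
    (h : Conj i₁ i₂ j₁ a c) (h' : Conj i₁ i₂ j₁ a c') (u : Fin m) {i : ℤ}
    (h₁ : i₁ ≤ i) (h₂ : i ≤ i₂ + 1) : c u i = c' u i := by
  have key : ∀ {c c' : Fin m → ℤ → ℤ}, IsColData i₁ i₂ j₁ k m c → IsColData i₁ i₂ j₁ k m c' →
      Conj i₁ i₂ j₁ a c → Conj i₁ i₂ j₁ a c' → c u i ≤ c' u i := by
    intro c c' hc hc' h h'
    have b := hc.bounds u h₁ h₂
    have b' := hc'.bounds u h₁ h₂
    by_contra! hlt
    have e := h i h₁ h₂ ⟨(c' u i - j₁ - (u : ℕ)).toNat, by omega⟩ u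
    have e' := h' i h₁ h₂ ⟨(c' u i - j₁ - (u : ℕ)).toNat, by omega⟩ u
    rw [e'] at e
    simp only at e
    omega
  exact le_antisymm (key hc hc' h h') (key hc' hc h' h)

lemma IsRowData.exists_conj (ha : IsRowData i₁ i₂ j₁ k m a) (h₁₂ : i₁ ≤ i₂) :
    ∃ c : Fin m → ℤ → ℤ, IsColData i₁ i₂ j₁ k m c ∧ Conj i₁ i₂ j₁ a c := by
  have hex : ∀ (u : Fin m) (i : ℤ), ∃ N : ℕ, N ≤ k ∧ (i₁ ≤ i → i ≤ i₂ + 1 →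
      ∀ t : Fin k, N ≤ (t : ℕ) ↔ ¬ a t i ≤ j₁ + (t : ℕ) + (u : ℕ)) := by
    intro u i
    by_cases hi : i₁ ≤ i ∧ i ≤ i₂ + 1
    · obtain ⟨N, hN, h⟩ := exists_threshold
        (P := fun t : Fin k => ¬ a t i ≤ j₁ + (t : ℕ) + (u : ℕ)) (by
          intro t t' htt' h
          have := add_sub_le_of_strictMono (ha.strict hi.1 hi.2) htt'
          omega)
      exact ⟨N, hN, fun _ _ => h⟩
    · exact ⟨0, Nat.zero_le _, fun h h' => absurd ⟨h, h'⟩ hi⟩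
  choose N hNk hN using hex
  have hlt : ∀ u i, i₁ ≤ i → i ≤ i₂ + 1 → ∀ t : Fin k,
      (t : ℕ) < N u i ↔ a t i ≤ j₁ + (t : ℕ) + (u : ℕ) := by
    intro u i h h' t
    rw [← not_le, hN u i h h' t, not_not]
  refine ⟨fun u i => j₁ + (u : ℕ) + N u i, ⟨?_, ?_, ?_, ?_⟩, ?_⟩
  · intro u
    have : N u i₁ = k := by
      by_contra hne
      have hk := hNk u i₁
      have := hlt u i₁ le_rfl (by omega) ⟨N u i₁, by omega⟩
      rw [ha.left] at this
      simp only at this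
      omega
    simp only [this]
    ring
  · intro u
    have : N u (i₂ + 1) = 0 := by
      by_contra hne
      have hk := hNk u (i₂ + 1)
      have := hlt u (i₂ + 1) (by omega) le_rfl ⟨0, by omega⟩
      rw [ha.right] at this
      simp only at this
      have := u.isLt
      omega
    simp [this]
  · intro u i h h'
    have hk := hNk u i
    have hk' := hNk u (i + 1)
    constructor
    · by_contra! hcon
      have e := (hlt u i h (by omega) ⟨N u (i + 1) + 1, by omega⟩).1 (by simp only; omega)
      have e' := mt (hlt u (i + 1) (by omega) (by omega) ⟨N u (i + 1), by omega⟩).2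
        (by simp only; omega)
      have := ha.sep ⟨N u (i + 1), by omega⟩ ⟨N u (i + 1) + 1, by omega⟩ (by simp) i h h'
      simp only at e e'
      push_cast at e
      omega
    · by_contra! hcon
      have e := (hlt u (i + 1) (by omega) (by omega) ⟨N u i, by omega⟩).1 (by simp only; omega)
      have e' := mt (hlt u i h (by omega) ⟨N u i, by omega⟩).2 (by simp only; omega)
      have := ha.mono ⟨N u i, by omega⟩ i h h'
      omega
  · intro u u' huu' i h h'
    have huu'' : (u : ℕ) < u' := huu'
    by_contra! hcon
    have hk := hNk u i
    have e := (hlt u i h h' ⟨N u' i, by omega⟩).1 (by simp only; omega)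
    have e' := mt (hlt u' i h h' ⟨N u' i, by omega⟩).2 (by simp only; omega)
    omega
  · intro i h h' t u
    rw [← hlt u i h h' t]
    beta_reduce
    omega

lemma IsColData.exists_conj (hc : IsColData i₁ i₂ j₁ k m c) (h₁₂ : i₁ ≤ i₂) :
    ∃ a : Fin k → ℤ → ℤ, IsRowData i₁ i₂ j₁ k m a ∧ Conj i₁ i₂ j₁ a c := by
  have hex : ∀ (t : Fin k) (i : ℤ), ∃ N : ℕ, N ≤ m ∧ (i₁ ≤ i → i ≤ i₂ + 1 →
      ∀ u : Fin m, N ≤ (u : ℕ) ↔ j₁ + (t : ℕ) + (u : ℕ) < c u i) := by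
    intro t i
    by_cases hi : i₁ ≤ i ∧ i ≤ i₂ + 1
    · obtain ⟨N, hN, h⟩ := exists_threshold
        (P := fun u : Fin m => j₁ + (t : ℕ) + (u : ℕ) < c u i) (by
          intro u u' huu' h
          have := add_sub_le_of_strictMono
            (g := fun u => c u i) (fun u u' h => hc.strict u u' h i hi.1 hi.2) huu'
          omega)
      exact ⟨N, hN, fun _ _ => h⟩
    · exact ⟨0, Nat.zero_le _, fun h h' => absurd ⟨h, h'⟩ hi⟩
  choose N hNm hN using hex
  refine ⟨fun t i => j₁ + (t : ℕ) + N t i, ⟨?_, ?_, ?_, ?_⟩, ?_⟩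
  · intro t
    have : N t i₁ = 0 := by
      by_contra hne
      have hm := hNm t i₁
      have := hN t i₁ le_rfl (by omega) ⟨0, by omega⟩
      rw [hc.left] at this
      simp only at this
      have := t.isLt
      omega
    simp [this]
  · intro t
    have : N t (i₂ + 1) = m := by
      by_contra hne
      have hm := hNm t (i₂ + 1)
      have := hN t (i₂ + 1) (by omega) le_rfl ⟨N t (i₂ + 1), by omega⟩
      rw [hc.right] at this
      simp only at this
      omega
    simp only [this]
    ring
  · intro t i h h'
    by_contra! hcon
    have hm := hNm t i
    have e := (hN t (i + 1) (by omega) (by omega) ⟨N t (i + 1), by omega⟩).1 le_rfl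
    have e' := mt (hN t i h (by omega) ⟨N t (i + 1), by omega⟩).2 (by simp only; omega)
    have := (hc.step ⟨N t (i + 1), by omega⟩ i h h').2
    omega
  · intro t t' htt' i h h'
    have htt'' : (t : ℕ) < t' := htt'
    by_contra! hcon
    have hm := hNm t (i + 1)
    have e := (hN t' i h (by omega) ⟨N t' i, by omega⟩).1 le_rfl
    have e' := mt (hN t (i + 1) (by omega) (by omega) ⟨N t' i, by omega⟩).2 (by simp only; omega)
    have := (hc.step ⟨N t' i, by omega⟩ i h h').1
    omega
  · intro i h h' t u
    rw [← hN t i h h' u]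
    beta_reduce
    omega

/-- A cell of row `i` of the interval is avoided by the lattice paths exactly when it is the tail
of a vertical edge of the conjugate system. -/
lemma Conj.exists_iff (ha : IsRowData i₁ i₂ j₁ k m a) (hc : IsColData i₁ i₂ j₁ k m c)
    (h : Conj i₁ i₂ j₁ a c) {i j : ℤ} (h₁ : i₁ ≤ i) (h₂ : i ≤ i₂)
    (hj₁ : j₁ ≤ j) (hj₂ : j < j₁ + k + m) :
    (∃ u, c u i = j ∧ c u (i + 1) = j) ↔ ¬ ∃ t, a t i ≤ j ∧ j ≤ a t (i + 1) := by
  constructor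
  · rintro ⟨u, hu, hu'⟩ ⟨t, ht, ht'⟩
    have e := h i h₁ (by omega) t u
    have e' := h (i + 1) (by omega) (by omega) t u
    omega
  · intro hno
    push Not at hno
    obtain ⟨T, hTk, hT⟩ := exists_threshold (P := fun t => j < a t i) (by
      intro t t' htt' hlt
      have := add_sub_le_of_strictMono (ha.strict h₁ (by omega)) htt'
      have htt'' : (t : ℕ) ≤ t' := htt'
      omega)
    have hlow : ∀ h0 : 0 < T, j₁ + T ≤ j ∧ a ⟨T - 1, by omega⟩ (i + 1) < j := by
      intro h0
      have e := mt (hT ⟨T - 1, by omega⟩).2 (by simp only; omega)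
      have e' := hno ⟨T - 1, by omega⟩ (by omega)
      have := (ha.bounds ⟨T - 1, by omega⟩ (i := i + 1) (by omega) (by omega)).1
      simp only at this
      omega
    have hhigh : ∀ hk : T < k, j < a ⟨T, hk⟩ i ∧ j < j₁ + T + m := by
      intro hk
      have e := (hT ⟨T, hk⟩).1 le_rfl
      have := (ha.bounds ⟨T, hk⟩ h₁ (by omega)).2
      simp only at this
      omega
    have hu₀ : j₁ + T ≤ j := by
      rcases Nat.eq_zero_or_pos T with h0 | h0
      · omega
      · exact (hlow h0).1
    have hu₁ : j < j₁ + T + m := by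
      rcases hTk.lt_or_eq with hk | hk
      · exact (hhigh hk).2
      · omega
    have key : ∀ i', i₁ ≤ i' → i' ≤ i₂ + 1 → (∀ h0 : 0 < T, a ⟨T - 1, by omega⟩ i' < j) →
        (∀ hk : T < k, j < a ⟨T, hk⟩ i') → c ⟨(j - j₁ - T).toNat, by omega⟩ i' = j := by
      intro i' h₁' h₂' hl hh
      have b := hc.bounds ⟨(j - j₁ - T).toNat, by omega⟩ h₁' h₂'
      simp only at b
      apply le_antisymm
      · by_contra! hcon
        have hk : T < k := by omega
        have e := (h i' h₁' h₂' ⟨T, hk⟩ ⟨(j - j₁ - T).toNat, by omega⟩).2 (by simp only; omega)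
        have := hh hk
        simp only at e
        omega
      · by_contra! hcon
        have h0 : 0 < T := by omega
        have e := (h i' h₁' h₂' ⟨T - 1, by omega⟩ ⟨(j - j₁ - T).toNat, by omega⟩).1
          (by have := hl h0; simp only; omega)
        simp only at e
        omega
    refine ⟨⟨(j - j₁ - T).toNat, by omega⟩, key i h₁ (by omega) ?_ (fun hk => (hhigh hk).1),
      key (i + 1) (by omega) (by omega) (fun h0 => (hlow h0).2) ?_⟩
    · intro h0
      exact (ha.mono _ i h₁ h₂).trans_lt (hlow h0).2
    · intro hk
      exact (hhigh hk).1.trans_le (ha.mono _ i h₁ h₂)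

lemma Conj.prod_row (ha : IsRowData i₁ i₂ j₁ k m a) (hc : IsColData i₁ i₂ j₁ k m c)
    (h : Conj i₁ i₂ j₁ a c) {i : ℤ} (h₁ : i₁ ≤ i) (h₂ : i ≤ i₂) (y : ℤ → ℝ)
    (hy : ∀ j ∈ Finset.Ico j₁ (j₁ + k + m), y j ≠ 0) :
    ∏ u, (if c u (i + 1) = c u i then (y (c u i))⁻¹ else 1) =
      (∏ t, ∏ j ∈ Finset.Icc (a t i) (a t (i + 1)), y j) /
        ∏ j ∈ Finset.Ico j₁ (j₁ + k + m), y j := by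
  classical
  set A := Finset.univ.biUnion fun t => Finset.Icc (a t i) (a t (i + 1)) with hA
  set C := (Finset.univ.filter fun u => c u (i + 1) = c u i).image fun u => c u i with hC
  have hAprod : ∏ t, ∏ j ∈ Finset.Icc (a t i) (a t (i + 1)), y j = ∏ j ∈ A, y j := by
    rw [hA, Finset.prod_biUnion]
    intro t _ t' _ hne
    rw [Function.onFun, Finset.disjoint_left]
    intro j hj hj'
    rw [Finset.mem_Icc] at hj hj'
    rcases lt_or_gt_of_ne hne with hlt | hlt
    · have := ha.sep _ _ hlt i h₁ h₂
      omega
    · have := ha.sep _ _ hlt i h₁ h₂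
      omega
  have hCprod : ∏ u, (if c u (i + 1) = c u i then (y (c u i))⁻¹ else 1) =
      (∏ j ∈ C, y j)⁻¹ := by
    rw [← Finset.prod_filter, hC, Finset.prod_image, Finset.prod_inv_distrib]
    intro u _ u' _ heq
    by_contra hne
    simp only at heq
    rcases lt_or_gt_of_ne hne with hlt | hlt
    · have := hc.strict _ _ hlt i h₁ (by omega)
      omega
    · have := hc.strict _ _ hlt i h₁ (by omega)
      omega
  have hunion : Finset.Ico j₁ (j₁ + k + m) = A ∪ C := by
    ext j
    simp only [hA, hC, Finset.mem_Ico, Finset.mem_union, Finset.mem_biUnion, Finset.mem_univ,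
      true_and, Finset.mem_Icc, Finset.mem_image, Finset.mem_filter]
    constructor
    · rintro ⟨hj₁, hj₂⟩
      by_cases hcov : ∃ t, a t i ≤ j ∧ j ≤ a t (i + 1)
      · exact Or.inl hcov
      · obtain ⟨u, hu, hu'⟩ := (h.exists_iff ha hc h₁ h₂ hj₁ hj₂).2 hcov
        exact Or.inr ⟨u, by omega, hu⟩
    · rintro (⟨t, ht, ht'⟩ | ⟨u, -, hu⟩)
      · have := (ha.bounds t h₁ (by omega)).1
        have := (ha.bounds t (i := i + 1) (by omega) (by omega)).2
        have := t.isLt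
        omega
      · have := hc.bounds u h₁ (by omega)
        have := u.isLt
        omega
  have hdisj : Disjoint A C := by
    rw [Finset.disjoint_left]
    intro j hjA hjC
    have hj : j ∈ Finset.Ico j₁ (j₁ + k + m) := hunion ▸ Finset.mem_union_left _ hjA
    rw [Finset.mem_Ico] at hj
    simp only [hA, hC, Finset.mem_biUnion, Finset.mem_univ, true_and, Finset.mem_Icc,
      Finset.mem_image, Finset.mem_filter] at hjA hjC
    obtain ⟨u, hu, hu'⟩ := hjC
    exact (h.exists_iff ha hc h₁ h₂ hj.1 hj.2).1 ⟨u, hu', by omega⟩ hjA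
  have hA0 : ∏ j ∈ A, y j ≠ 0 :=
    Finset.prod_ne_zero_iff.2 fun j hj => hy j (hunion ▸ Finset.mem_union_left _ hj)
  rw [hAprod, hCprod, hunion, Finset.prod_union hdisj]
  field_simp

end Conjugation

section Lists

lemma eq_of_chain_of_mem_iff {R : ℤ × ℤ → ℤ × ℤ → Prop} (g : ℤ × ℤ → ℤ)
    (hR : ∀ p q, R p q → g p < g q) {l l' : List (ℤ × ℤ)} (hl : l.IsChain R) (hl' : l'.IsChain R)
    (h : ∀ v, v ∈ l ↔ v ∈ l') : l = l' := by
  have : Trans (fun p q : ℤ × ℤ => g p < g q) (fun p q => g p < g q) (fun p q => g p < g q) :=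
    ⟨fun h h' => lt_trans h h'⟩
  have hp := List.isChain_iff_pairwise.1 (hl.imp hR)
  have hp' := List.isChain_iff_pairwise.1 (hl'.imp hR)
  have hperm : l.Perm l' := (List.perm_ext_iff_of_nodup
    (hp.imp fun hab he => (he ▸ hab).false) (hp'.imp fun hab he => (he ▸ hab).false)).2 h
  exact hperm.eq_of_pairwise (fun _ _ _ _ h h' => absurd h (lt_asymm h')) hp hp'

lemma nodup_of_isChain {R : ℤ × ℤ → ℤ × ℤ → Prop} (g : ℤ × ℤ → ℤ)
    (hR : ∀ p q, R p q → g p < g q) {l : List (ℤ × ℤ)} (hl : l.IsChain R) : l.Nodup := by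
  have : Trans (fun p q : ℤ × ℤ => g p < g q) (fun p q => g p < g q) (fun p q => g p < g q) :=
    ⟨fun h h' => lt_trans h h'⟩
  exact (List.isChain_iff_pairwise.1 (hl.imp hR)).imp fun hab he => (he ▸ hab).false

lemma CoverStep.lt {p q : ℤ × ℤ} (h : CoverStep p q) : p.1 + p.2 < q.1 + q.2 := by
  unfold CoverStep at h
  omega

lemma GEdge.lt {r s : ℕ} {p q : ℤ × ℤ} (h : GEdge r s p q) : p.1 < q.1 := by
  unfold GEdge at h
  omega

lemma exists_rowFun {i₂ q : ℤ} (l : List (ℤ × ℤ)) : ∀ {i₁ p : ℤ}, l.IsChain CoverStep →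
    l.head? = some (i₁, p) → l.getLast? = some (i₂, q) →
    ∃ a : ℤ → ℤ, a i₁ = p ∧ a (i₂ + 1) = q ∧ i₁ ≤ i₂ ∧
      (∀ i, i₁ ≤ i → i ≤ i₂ → a i ≤ a (i + 1)) ∧
      ∀ v, v ∈ l ↔ (i₁ ≤ v.1 ∧ v.1 ≤ i₂) ∧ a v.1 ≤ v.2 ∧ v.2 ≤ a (v.1 + 1) := by
  induction l with
  | nil => simp
  | cons v l ih =>
    intro i₁ p hl hhead hlast
    obtain rfl : v = (i₁, p) := by simpa using hhead
    cases l with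
    | nil =>
      obtain ⟨rfl, rfl⟩ : i₁ = i₂ ∧ p = q := by simpa using hlast
      refine ⟨fun _ => p, rfl, rfl, le_rfl, fun _ _ _ => le_rfl, fun v => ?_⟩
      rw [List.mem_singleton, Prod.ext_iff]
      simp only
      omega
    | cons v' l =>
      rw [List.isChain_cons_cons] at hl
      obtain ⟨⟨h₁, h₂⟩ | ⟨h₁, h₂⟩, hl⟩ := hl
      all_goals
        obtain ⟨a, hap, haq, hle, hmono, hmem⟩ :=
          ih hl (i₁ := v'.1) (p := v'.2) rfl (by rwa [List.getLast?_cons_cons] at hlast)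
        simp only at h₁ h₂
        rw [h₁] at hap hle hmono
        refine ⟨fun i => if i = i₁ then p else a i, if_pos rfl, ?_, by omega, ?_, ?_⟩
        · exact (if_neg (by omega)).trans haq
        · intro i hi hi'
          beta_reduce
          rw [if_neg (show i + 1 ≠ i₁ by omega)]
          split_ifs with h
          · subst h
            first
            | omega
            | exact le_trans (by omega) (hmono i le_rfl hi')
          · exact hmono i (by omega) hi'
        · rintro ⟨i, j⟩
          rw [List.mem_cons, hmem]
          simp only [Prod.mk.injEq, h₁]
          by_cases hi : i₁ ≤ i
          swap
          · constructor <;> intro h <;> omega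
          rw [if_neg (show i + 1 ≠ i₁ by omega)]
          split_ifs with h
          · subst h
            have := hmono i
            omega
          · omega

lemma exists_list_of_rowFun {i₂ : ℤ} (n : ℕ) : ∀ {i₁ : ℤ} {a : ℤ → ℤ}, i₁ ≤ i₂ →
    (∀ i, i₁ ≤ i → i ≤ i₂ → a i ≤ a (i + 1)) → (i₂ - i₁) + (a (i₂ + 1) - a i₁) = n →
    ∃ l : List (ℤ × ℤ), l.IsChain CoverStep ∧ l.head? = some (i₁, a i₁) ∧
      l.getLast? = some (i₂, a (i₂ + 1)) ∧
      ∀ v, v ∈ l ↔ (i₁ ≤ v.1 ∧ v.1 ≤ i₂) ∧ a v.1 ≤ v.2 ∧ v.2 ≤ a (v.1 + 1) := by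
  induction n with
  | zero =>
    intro i₁ a hle hmono hn
    have := le_of_le_step (q := i₂ + 1) (fun i h h' => hmono i h (by omega)) le_rfl
      (show i₁ ≤ i₂ + 1 by omega) le_rfl
    obtain rfl : i₁ = i₂ := by omega
    refine ⟨[(i₁, a i₁)], by simp, by simp, ?_, ?_⟩
    · simp only [List.getLast?_singleton, Option.some.injEq, Prod.mk.injEq, true_and]
      omega
    · rintro ⟨i, j⟩
      simp only [List.mem_singleton, Prod.mk.injEq]
      constructor
      · rintro ⟨rfl, rfl⟩
        omega
      · rintro ⟨h, h'⟩
        obtain rfl : i = i₁ := by omega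
        omega
  | succ n ih =>
    intro i₁ a hle hmono hn
    rcases (hmono i₁ le_rfl hle).lt_or_eq with hlt | heq
    · obtain ⟨l, hl, hhead, hlast, hmem⟩ := ih (i₁ := i₁)
        (a := fun i => if i = i₁ then a i₁ + 1 else a i) hle (by
          intro i hi hi'
          rw [if_neg (show i + 1 ≠ i₁ by omega)]
          split_ifs with h
          · subst h
            omega
          · exact hmono i hi hi') (by
          rw [if_neg (show i₂ + 1 ≠ i₁ by omega), if_pos rfl]
          push_cast at hn
          omega)
      simp only [if_true] at hhead
      rw [if_neg (show i₂ + 1 ≠ i₁ by omega)] at hlast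
      match l, hl, hhead, hlast, hmem with
      | v :: l, hl, hhead, hlast, hmem =>
        obtain rfl : v = (i₁, a i₁ + 1) := by simpa using hhead
        refine ⟨(i₁, a i₁) :: (i₁, a i₁ + 1) :: l, ?_, rfl, ?_, ?_⟩
        · exact List.isChain_cons_cons.2 ⟨Or.inr ⟨rfl, rfl⟩, hl⟩
        · rwa [List.getLast?_cons_cons]
        · rintro ⟨i, j⟩
          rw [List.mem_cons, hmem]
          simp only [Prod.mk.injEq]
          by_cases hi : i₁ ≤ i
          swap
          · constructor <;> intro h <;> omega
          rw [if_neg (show i + 1 ≠ i₁ by omega)]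
          split_ifs with h
          · subst h
            omega
          · omega
    · have hlt : i₁ < i₂ := by
        refine lt_of_le_of_ne hle ?_
        rintro rfl
        push_cast at hn
        omega
      obtain ⟨l, hl, hhead, hlast, hmem⟩ := ih (i₁ := i₁ + 1) (a := a) (by omega)
        (fun i hi hi' => hmono i (by omega) hi') (by push_cast at hn; omega)
      match l, hl, hhead, hlast, hmem with
      | v :: l, hl, hhead, hlast, hmem =>
        obtain rfl : v = (i₁ + 1, a (i₁ + 1)) := by simpa using hhead
        refine ⟨(i₁, a i₁) :: (i₁ + 1, a (i₁ + 1)) :: l, ?_, rfl, ?_, ?_⟩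
        · exact List.isChain_cons_cons.2 ⟨Or.inl ⟨rfl, heq.symm⟩, hl⟩
        · rwa [List.getLast?_cons_cons]
        · rintro ⟨i, j⟩
          rw [List.mem_cons, hmem]
          simp only [Prod.mk.injEq]
          by_cases hi : i = i₁
          · subst hi
            omega
          · omega

lemma prod_map_of_rowFun {i₁ i₂ : ℤ} {a : ℤ → ℤ} {l : List (ℤ × ℤ)} (hl : l.IsChain CoverStep)
    (hmem : ∀ v, v ∈ l ↔ (i₁ ≤ v.1 ∧ v.1 ≤ i₂) ∧ a v.1 ≤ v.2 ∧ v.2 ≤ a (v.1 + 1))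
    (x : ℤ × ℤ → ℝ) :
    (l.map x).prod = ∏ i ∈ Finset.Icc i₁ i₂, ∏ j ∈ Finset.Icc (a i) (a (i + 1)), x (i, j) := by
  rw [← List.prod_toFinset x (nodup_of_isChain (fun p => p.1 + p.2) (fun _ _ h => h.lt) hl)]
  apply Finset.prod_finset_product
  intro v
  simp only [List.mem_toFinset, hmem, Finset.mem_Icc]

lemma exists_colFun {r s : ℕ} {i₂ q : ℤ} (l : List (ℤ × ℤ)) : ∀ {i₁ p : ℤ},
    l.IsChain (GEdge r s) → l.head? = some (i₁, p) → l.getLast? = some (i₂, q) →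
    ∃ c : ℤ → ℤ, c i₁ = p ∧ c i₂ = q ∧ i₁ ≤ i₂ ∧
      (∀ i, i₁ ≤ i → i < i₂ → GEdge r s (i, c i) (i + 1, c (i + 1))) ∧
      ∀ v, v ∈ l ↔ (i₁ ≤ v.1 ∧ v.1 ≤ i₂) ∧ v.2 = c v.1 := by
  induction l with
  | nil => simp
  | cons v l ih =>
    intro i₁ p hl hhead hlast
    obtain rfl : v = (i₁, p) := by simpa using hhead
    cases l with
    | nil =>
      obtain ⟨rfl, rfl⟩ : i₁ = i₂ ∧ p = q := by simpa using hlast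
      refine ⟨fun _ => p, rfl, rfl, le_rfl, fun _ _ _ => by omega, fun v => ?_⟩
      rw [List.mem_singleton, Prod.ext_iff]
      simp only
      omega
    | cons v' l =>
      rw [List.isChain_cons_cons] at hl
      obtain ⟨hedge, hl⟩ := hl
      obtain ⟨c, hcp, hcq, hle, hstep, hmem⟩ :=
        ih hl (i₁ := v'.1) (p := v'.2) rfl (by rwa [List.getLast?_cons_cons] at hlast)
      have h₁ : v'.1 = i₁ + 1 := hedge.2.2.2.2.1
      obtain ⟨v₁, v₂⟩ := v'
      simp only at h₁ hcp hle hstep hmem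
      subst h₁
      refine ⟨fun i => if i = i₁ then p else c i, if_pos rfl, ?_, by omega, ?_, ?_⟩
      · exact (if_neg (by omega)).trans hcq
      · intro i hi hi'
        beta_reduce
        rw [if_neg (show i + 1 ≠ i₁ by omega)]
        split_ifs with h
        · subst h
          rwa [hcp]
        · exact hstep i (by omega) hi'
      · rintro ⟨i, j⟩
        rw [List.mem_cons, hmem]
        simp only [Prod.mk.injEq]
        split_ifs with h <;> omega

lemma exists_list_of_colFun {r s : ℕ} {i₂ : ℤ} (n : ℕ) : ∀ {i₁ : ℤ} {c : ℤ → ℤ}, i₁ ≤ i₂ →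
    (∀ i, i₁ ≤ i → i < i₂ → GEdge r s (i, c i) (i + 1, c (i + 1))) → i₂ - i₁ = n →
    ∃ l : List (ℤ × ℤ), l.IsChain (GEdge r s) ∧ l.head? = some (i₁, c i₁) ∧
      l.getLast? = some (i₂, c i₂) ∧
      ∀ v, v ∈ l ↔ (i₁ ≤ v.1 ∧ v.1 ≤ i₂) ∧ v.2 = c v.1 := by
  induction n with
  | zero =>
    intro i₁ c hle hstep hn
    obtain rfl : i₁ = i₂ := by omega
    refine ⟨[(i₁, c i₁)], by simp, by simp, by simp, ?_⟩
    rintro ⟨i, j⟩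
    simp only [List.mem_singleton, Prod.mk.injEq]
    constructor
    · rintro ⟨rfl, rfl⟩
      omega
    · rintro ⟨h, h'⟩
      obtain rfl : i = i₁ := by omega
      omega
  | succ n ih =>
    intro i₁ c hle hstep hn
    push_cast at hn
    obtain ⟨l, hl, hhead, hlast, hmem⟩ := ih (i₁ := i₁ + 1) (c := c) (by omega)
      (fun i hi hi' => hstep i (by omega) hi') (by omega)
    match l, hl, hhead, hlast, hmem with
    | v :: l, hl, hhead, hlast, hmem =>
      obtain rfl : v = (i₁ + 1, c (i₁ + 1)) := by simpa using hhead
      refine ⟨(i₁, c i₁) :: (i₁ + 1, c (i₁ + 1)) :: l, ?_, rfl, ?_, ?_⟩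
      · exact List.isChain_cons_cons.2 ⟨hstep i₁ le_rfl (by omega), hl⟩
      · rwa [List.getLast?_cons_cons]
      · rintro ⟨i, j⟩
        rw [List.mem_cons, hmem]
        simp only [Prod.mk.injEq]
        by_cases hi : i = i₁
        · subst hi
          omega
        · omega

lemma listWt_cons_cons (x : ℤ × ℤ → ℝ) (p q : ℤ × ℤ) (l : List (ℤ × ℤ)) :
    listWt x (p :: q :: l) = edgeWt x p q * listWt x (q :: l) := by
  simp [listWt]

lemma listWt_of_colFun {r s : ℕ} {i₂ : ℤ} {c : ℤ → ℤ} (x : ℤ × ℤ → ℝ) (l : List (ℤ × ℤ)) :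
    ∀ {i₁ : ℤ}, l.IsChain (GEdge r s) → l.head? = some (i₁, c i₁) →
      l.getLast? = some (i₂, c i₂) → (∀ v ∈ l, v.2 = c v.1) →
      listWt x l = ∏ i ∈ Finset.Ico i₁ i₂, if c (i + 1) = c i then (x (i, c i))⁻¹ else 1 := by
  induction l with
  | nil => simp
  | cons v l ih =>
    intro i₁ hl hhead hlast hmem
    obtain rfl : v = (i₁, c i₁) := by simpa using hhead
    cases l with
    | nil =>
      obtain ⟨rfl, -⟩ : i₁ = i₂ ∧ c i₁ = c i₂ := by simpa using hlast
      simp [listWt]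
    | cons v' l =>
      rw [List.isChain_cons_cons] at hl
      obtain ⟨hedge, hl⟩ := hl
      obtain ⟨v₁, v₂⟩ := v'
      obtain rfl : v₁ = i₁ + 1 := hedge.2.2.2.2.1
      obtain rfl : v₂ = c (i₁ + 1) := hmem (i₁ + 1, v₂) (by simp)
      rw [List.getLast?_cons_cons] at hlast
      obtain ⟨-, -, -, hle, -⟩ := exists_colFun _ hl rfl hlast
      rw [listWt_cons_cons, ih hl rfl hlast fun v hv => hmem v (List.mem_cons_of_mem _ hv),
        ← Finset.insert_Ico_add_one_left_eq_Ico (show i₁ < i₂ by omega), Finset.prod_insert]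
      · rfl
      · simp

end Lists

section Systems

variable {r s : ℕ} {i₁ i₂ j₁ j₂ : ℤ} {k m : ℕ}

/-- The row functions `a` describe the vertices of the collection `L`. -/
def RSys.Rep (L : RSys i₁ i₂ j₁ j₂ k) (a : Fin k → ℤ → ℤ) : Prop :=
  ∀ t v, v ∈ L.path t ↔ (i₁ ≤ v.1 ∧ v.1 ≤ i₂) ∧ a t v.1 ≤ v.2 ∧ v.2 ≤ a t (v.1 + 1)

lemma RSys.ext_path {L L' : RSys i₁ i₂ j₁ j₂ k} (h : L.path = L'.path) : L = L' := by
  cases L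
  cases L'
  cases h
  rfl

lemma RSys.exists_rep (L : RSys i₁ i₂ j₁ (j₁ + k + m - 1) k) :
    ∃ a, IsRowData i₁ i₂ j₁ k m a ∧ L.Rep a := by
  choose a hleft hright _ hmono hmem using fun t =>
    exists_rowFun (L.path t) (L.chain t) (L.first t) (L.final t)
  have hright' : ∀ t, a t (i₂ + 1) = j₁ + m + (t : ℕ) := fun t => by
    rw [hright]
    ring
  have hsep : ∀ t t', t < t' → ∀ i, i₁ ≤ i → i ≤ i₂ → a t i < a t' i → a t (i + 1) < a t' i := by
    intro t t' htt' i h h' hlt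
    by_contra! hcon
    exact L.disjoint t t' htt'.ne (i, a t' i) ((hmem t _).2 ⟨⟨h, h'⟩, hlt.le, hcon⟩)
      ((hmem t' _).2 ⟨⟨h, h'⟩, le_rfl, hmono t' i h h'⟩)
  refine ⟨a, ⟨hleft, hright', hmono, fun t t' htt' i h h' => hsep t t' htt' i h h' ?_⟩, hmem⟩
  have htt'' : (t : ℕ) < t' := htt'
  induction i, h using Int.leInduction with
  | base =>
    rw [hleft, hleft]
    omega
  | succ n hn ih =>
    exact (hsep t t' htt' n hn (by omega) (ih (by omega))).trans_le (hmono t' n hn (by omega))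

lemma IsRowData.exists_sys {a : Fin k → ℤ → ℤ} (ha : IsRowData i₁ i₂ j₁ k m a) (h₁₂ : i₁ ≤ i₂) :
    ∃ L : RSys i₁ i₂ j₁ (j₁ + k + m - 1) k, L.Rep a := by
  have hlist := fun t => exists_list_of_rowFun (i₂ := i₂) (i₁ := i₁) (a := a t)
    (i₂ - i₁ + (a t (i₂ + 1) - a t i₁)).toNat h₁₂ (ha.mono t) (by
      rw [ha.left, ha.right]
      omega)
  choose l hl hhead hlast hmem using hlist
  refine ⟨⟨l, hl, fun t v hv => ?_, fun t => ?_, fun t => ?_, fun t t' hne v hv hv' => ?_⟩, hmem⟩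
  · rw [hmem] at hv
    have := (ha.bounds t (i := v.1) (by omega) (by omega)).1
    have := (ha.bounds t (i := v.1 + 1) (by omega) (by omega)).2
    have := t.isLt
    omega
  · rw [hhead, ha.left]
  · rw [hlast, ha.right]
    congr 2
    ring
  · rw [hmem] at hv hv'
    rcases lt_or_gt_of_ne hne with hlt | hlt
    · have := ha.sep _ _ hlt v.1 (by omega) (by omega)
      omega
    · have := ha.sep _ _ hlt v.1 (by omega) (by omega)
      omega

lemma RSys.Rep.sys_unique {L L' : RSys i₁ i₂ j₁ j₂ k} {a a' : Fin k → ℤ → ℤ} (h : L.Rep a)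
    (h' : L'.Rep a') (haa' : ∀ t i, i₁ ≤ i → i ≤ i₂ + 1 → a t i = a' t i) : L = L' := by
  refine RSys.ext_path (funext fun t => eq_of_chain_of_mem_iff (fun p => p.1 + p.2)
    (fun _ _ h => h.lt) (L.chain t) (L'.chain t) fun v => ?_)
  rw [h, h']
  refine and_congr_right fun hv => ?_
  rw [haa' t v.1 hv.1 (by omega), haa' t (v.1 + 1) (by omega) (by omega)]

lemma RSys.Rep.row_unique {L : RSys i₁ i₂ j₁ j₂ k} {a a' : Fin k → ℤ → ℤ}
    (ha : IsRowData i₁ i₂ j₁ k m a) (ha' : IsRowData i₁ i₂ j₁ k m a') (h : L.Rep a)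
    (h' : L.Rep a') (t : Fin k) {i : ℤ} (h₁ : i₁ ≤ i) (h₂ : i ≤ i₂ + 1) : a t i = a' t i := by
  rcases h₂.lt_or_eq with h₂ | rfl
  · have e := ((h' t (i, a t i)).1 ((h t _).2 ⟨⟨h₁, by simp only; omega⟩, le_rfl,
      ha.mono t i h₁ (by omega)⟩)).2.1
    have e' := ((h t (i, a' t i)).1 ((h' t _).2 ⟨⟨h₁, by simp only; omega⟩, le_rfl,
      ha'.mono t i h₁ (by omega)⟩)).2.1
    exact le_antisymm e' e
  · rw [ha.right, ha'.right]

lemma RSys.Rep.weight {L : RSys i₁ i₂ j₁ j₂ k} {a : Fin k → ℤ → ℤ} (h : L.Rep a)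
    (x : ℤ × ℤ → ℝ) : RSysWeight x L =
      ∏ i ∈ Finset.Icc i₁ i₂, ∏ t, ∏ j ∈ Finset.Icc (a t i) (a t (i + 1)), x (i, j) := by
  rw [Finset.prod_comm]
  exact Finset.prod_congr rfl fun t _ => prod_map_of_rowFun (L.chain t) (h t) x

lemma Pvert_spec (s : ℕ) (t : ℤ) : (Pvert s t).1 + (Pvert s t).2 = t + 1 ∧ (Pvert s t).2 ≤ s ∧
    1 ≤ (Pvert s t).1 ∧ ((Pvert s t).1 = 1 ∨ (Pvert s t).2 = s) := by
  unfold Pvert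
  split_ifs with h
  · exact ⟨add_comm _ _, h, le_rfl, Or.inl rfl⟩
  · exact ⟨by simp only; omega, le_rfl, by simp only; omega, Or.inr rfl⟩

lemma Qvert_spec (r : ℕ) (t : ℤ) : (Qvert r t).1 + (Qvert r t).2 = t + 1 ∧
    (Qvert r t).1 ≤ r + 1 ∧ 1 ≤ (Qvert r t).2 ∧ ((Qvert r t).2 = 1 ∨ (Qvert r t).1 = r + 1) := by
  unfold Qvert
  split_ifs with h
  · exact ⟨rfl, by simp only; omega, le_rfl, Or.inl rfl⟩
  · exact ⟨by simp only; omega, le_rfl, by simp only; omega, Or.inr rfl⟩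

/-- Extension of the column data `c` to all rows by the forced diagonal steps. -/
def extCol (i₁ i₂ j₁ : ℤ) (k : ℕ) {m : ℕ} (c : Fin m → ℤ → ℤ) (u : Fin m) (i : ℤ) : ℤ :=
  if i < i₁ then i₁ + j₁ + k + (u : ℕ) - i
  else if i₂ + 1 < i then i₂ + 1 + j₁ + (u : ℕ) - i else c u i

/-- The column functions `c` describe the vertices of the collection `L`, whose paths join the
sources to the sinks in order. -/
def GSys.Rep (L : GSys r s (i₁ + j₁ + k - 1) (i₂ + j₁) m) (c : Fin m → ℤ → ℤ) : Prop :=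
  L.perm = 1 ∧ ∀ u v, v ∈ L.path u ↔ ((Pvert s (i₁ + j₁ + k - 1 + (u : ℕ))).1 ≤ v.1 ∧
    v.1 ≤ (Qvert r (i₂ + j₁ + (u : ℕ))).1) ∧ v.2 = extCol i₁ i₂ j₁ k c u v.1

lemma GSys.ext_path {i j : ℤ} {L L' : GSys r s i j m} (hp : L.perm = L'.perm)
    (h : L.path = L'.path) : L = L' := by
  cases L
  cases L'
  cases h
  cases hp
  rfl

lemma GEdge.step {i c c' : ℤ} (h : GEdge r s (i, c) (i + 1, c')) : c - 1 ≤ c' ∧ c' ≤ c := by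
  unfold GEdge at h
  simp only at h
  omega

/-- The interval `[i₁, i₂] × [j₁, j₁ + k + m - 1]` of `[r] × [s]` touches the boundary as required
for its path systems to be read off from `𝒢_R`. -/
structure IsCorner (r s : ℕ) (i₁ i₂ j₁ : ℤ) (k m : ℕ) : Prop where
  one_le_row : 1 ≤ i₁
  row_le : i₁ ≤ i₂
  le_row : i₂ ≤ r
  one_le_col : 1 ≤ j₁
  col_le : j₁ + k + m - 1 ≤ s
  source : i₁ = 1 ∨ j₁ + k + m - 1 = s
  sink : j₁ = 1 ∨ i₂ = r

lemma IsCorner.rows (hI : IsCorner r s i₁ i₂ j₁ k m) (u : Fin m) :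
    (Pvert s (i₁ + j₁ + k - 1 + (u : ℕ))).1 ≤ i₁ ∧ i₂ + 1 ≤ (Qvert r (i₂ + j₁ + (u : ℕ))).1 := by
  obtain ⟨h₁, h₂, h₃, h₄, h₅, h₆, h₇⟩ := hI
  have := Pvert_spec s (i₁ + j₁ + k - 1 + (u : ℕ))
  have := Qvert_spec r (i₂ + j₁ + (u : ℕ))
  have := u.isLt
  omega

lemma perm_eq_one_of_strictMono {π : Equiv.Perm (Fin m)} (h : StrictMono π) : π = 1 :=
  Equiv.ext fun u => congrFun ((h.range_inj strictMono_id).1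
    (by rw [π.surjective.range_eq, Set.range_id])) u

lemma GSys.exists_rep (hI : IsCorner r s i₁ i₂ j₁ k m)
    (L : GSys r s (i₁ + j₁ + k - 1) (i₂ + j₁) m) :
    ∃ c, IsColData i₁ i₂ j₁ k m c ∧ L.Rep c := by
  obtain ⟨π, path, chain, first, final, disjoint⟩ := L
  have hrows := hI.rows
  obtain ⟨h₁, h₂, h₃, h₄, h₅, h₆, h₇⟩ := hI
  have hP := fun u : Fin m => Pvert_spec s (i₁ + j₁ + k - 1 + (u : ℕ))
  have hQ := fun u : Fin m => Qvert_spec r (i₂ + j₁ + (u : ℕ))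
  obtain ⟨P, hPu⟩ : ∃ P : Fin m → ℤ × ℤ, ∀ u : Fin m,
    Pvert s (i₁ + j₁ + k - 1 + ((u : ℕ) : ℤ)) = P u :=
    ⟨_, fun _ => rfl⟩
  obtain ⟨Q, hQu⟩ : ∃ Q : Fin m → ℤ × ℤ, ∀ u : Fin m, Qvert r (i₂ + j₁ + ((u : ℕ) : ℤ)) = Q u :=
    ⟨_, fun _ => rfl⟩
  simp only [hPu, hQu] at hrows hP hQ first final
  choose f hfP hfQ hle hstep hmem using fun u =>
    exists_colFun (i₁ := (P u).1) (p := (P u).2) (i₂ := (Q (π u)).1) (q := (Q (π u)).2)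
      (path u) (chain u) (first u) (final u)
  have hanti : ∀ u i j, (P u).1 ≤ i → i ≤ j → j ≤ (Q (π u)).1 → f u j ≤ f u i :=
    fun u i j h h' h'' => ge_of_ge_step (fun i h h' => (hstep u i h h').step.2) h h' h''
  have hlow : ∀ u i j, (P u).1 ≤ i → i ≤ j → j ≤ (Q (π u)).1 → f u i - (j - i) ≤ f u j :=
    fun u i j h h' h'' => sub_le_of_sub_one_le_step (fun i h h' => (hstep u i h h').step.1) h h' h''
  have hbd : ∀ u i, (P u).1 ≤ i → i ≤ (Q (π u)).1 → 1 ≤ f u i ∧ f u i ≤ s := by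
    intro u i h h'
    have e := hanti u _ i le_rfl h h'
    have e' := hanti u i _ h h' le_rfl
    rw [hfP] at e
    rw [hfQ] at e'
    have := hP u
    have := hQ (π u)
    omega
  have hne : ∀ u u', u ≠ u' → ∀ i, (P u).1 ≤ i → i ≤ (Q (π u)).1 → (P u').1 ≤ i →
      i ≤ (Q (π u')).1 → f u i ≠ f u' i := fun u u' hne i h h' h'' h''' heq =>
    disjoint u u' hne (i, f u i) ((hmem u _).2 ⟨⟨h, h'⟩, rfl⟩) ((hmem u' _).2 ⟨⟨h'', h'''⟩, heq⟩)
  have hPle : ∀ u u', u < u' → (P u).1 ≤ (P u').1 := by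
    intro u u' huu'
    have huu'' : (u : ℕ) < u' := huu'
    have := hP u
    have := hP u'
    omega
  have hlt : ∀ u u', u < u' → ∀ i, (P u').1 ≤ i → i ≤ (Q (π u)).1 → i ≤ (Q (π u')).1 →
      f u i < f u' i := by
    intro u u' huu' i h
    have huu'' : (u : ℕ) < u' := huu'
    induction i, h using Int.leInduction with
    | base =>
      intro h' h''
      have e := hne u u' huu'.ne _ (hPle u u' huu') h' le_rfl h''
      have e' := (hbd u _ (hPle u u' huu') h').2
      have e'' := hanti u _ _ le_rfl (hPle u u' huu') h'
      rw [hfP] at e e'' ⊢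
      have := hP u
      have := hP u'
      omega
    | succ n hn ih =>
      intro h' h''
      have e := ih (by omega) (by omega)
      have hn' := (hPle u u' huu').trans hn
      have e' := hne u u' huu'.ne (n + 1) (by omega) h' (by omega) h''
      have e₁ := (hstep u n hn' (by omega)).step
      have e₂ := (hstep u' n hn (by omega)).step
      omega
  have hπ : π = 1 := by
    refine perm_eq_one_of_strictMono fun u u' huu' => ?_
    by_contra hcon
    have hlt' : π u' < π u := lt_of_le_of_ne (not_lt.1 hcon) fun h => huu'.ne' (π.injective h)
    have hlt'' : ((π u' : Fin m) : ℕ) < π u := hlt'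
    have q := hQ (π u)
    have q' := hQ (π u')
    have e := hlt u u' huu' (Q (π u')).1 (hle u') (by omega) le_rfl
    have e' := (hbd u (Q (π u')).1 ((hPle u u' huu').trans (hle u')) (by omega)).1
    have e'' := hanti u (Q (π u')).1 _ ((hPle u u' huu').trans (hle u')) (by omega) le_rfl
    rw [hfQ] at e e''
    omega
  subst hπ
  simp only [Equiv.Perm.coe_one, id_eq] at *
  have hstrict : ∀ i, i₁ ≤ i → i ≤ i₂ + 1 → ∀ u u', u < u' → f u i < f u' i := by
    intro i h h' u u' huu'
    have := hrows u
    have := hrows u'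
    exact hlt u u' huu' i (by omega) (by omega) (by omega)
  have hleft : ∀ u, f u i₁ = j₁ + k + (u : ℕ) := by
    intro u
    have hu := u.isLt
    have hr := hrows u
    have e := hlow u _ i₁ le_rfl hr.1 (by omega)
    have e' := hanti u _ i₁ le_rfl hr.1 (by omega)
    rw [hfP] at e e'
    have g := add_sub_le_of_strictMono (hstrict i₁ le_rfl (by omega))
      (t := u) (t' := ⟨m - 1, by omega⟩) (Fin.le_def.2 (by simp only; omega))
    have hr' := hrows ⟨m - 1, by omega⟩
    have b := (hbd ⟨m - 1, by omega⟩ i₁ (by omega) (by omega)).2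
    have := hP u
    simp only at g
    omega
  have hright : ∀ u, f u (i₂ + 1) = j₁ + (u : ℕ) := by
    intro u
    have hu := u.isLt
    have hr := hrows u
    have e := hlow u (i₂ + 1) _ (by omega) hr.2 le_rfl
    have e' := hanti u (i₂ + 1) _ (by omega) hr.2 le_rfl
    rw [hfQ] at e e'
    have g := add_sub_le_of_strictMono (hstrict (i₂ + 1) (by omega) le_rfl)
      (t := ⟨0, by omega⟩) (t' := u) (Fin.le_def.2 (by simp only; omega))
    have hr' := hrows ⟨0, by omega⟩
    have b := (hbd ⟨0, by omega⟩ (i₂ + 1) (by omega) (by omega)).1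
    have := hQ u
    simp only at g
    omega
  refine ⟨f, ⟨hleft, hright, fun u i h h' => ?_, fun u u' huu' i h h' => hstrict i h h' u u' huu'⟩,
    rfl, fun u v => ?_⟩
  · have := hrows u
    exact (hstep u i (by omega) (by omega)).step
  · rw [hPu, hQu]
    refine (hmem u v).trans (and_congr_right fun hv => ?_)
    suffices hext : extCol i₁ i₂ j₁ k f u v.1 = f u v.1 by rw [hext]
    have hr := hrows u
    unfold extCol
    split_ifs with hv₁ hv₂
    · have e := hlow u _ v.1 le_rfl hv.1 hv.2
      have e' := hlow u v.1 i₁ hv.1 hv₁.le (by omega)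
      rw [hfP] at e
      rw [hleft] at e'
      have := hP u
      omega
    · have e := hlow u v.1 _ hv.1 hv.2 le_rfl
      have e' := hlow u (i₂ + 1) v.1 (by omega) hv₂.le hv.2
      rw [hfQ] at e
      rw [hright] at e'
      have := hQ u
      omega
    · rfl

lemma IsColData.extCol_source (hI : IsCorner r s i₁ i₂ j₁ k m) {c : Fin m → ℤ → ℤ}
    (hc : IsColData i₁ i₂ j₁ k m c) (u : Fin m) :
    extCol i₁ i₂ j₁ k c u (Pvert s (i₁ + j₁ + k - 1 + (u : ℕ))).1 =
      (Pvert s (i₁ + j₁ + k - 1 + (u : ℕ))).2 := by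
  have hr := hI.rows u
  have h₂ := hI.row_le
  have hP := Pvert_spec s (i₁ + j₁ + k - 1 + (u : ℕ))
  unfold extCol
  split_ifs with h h'
  · omega
  · omega
  · rw [show (Pvert s (i₁ + j₁ + k - 1 + (u : ℕ))).1 = i₁ by omega, hc.left]
    omega

lemma IsColData.extCol_sink (hI : IsCorner r s i₁ i₂ j₁ k m) {c : Fin m → ℤ → ℤ}
    (hc : IsColData i₁ i₂ j₁ k m c) (u : Fin m) :
    extCol i₁ i₂ j₁ k c u (Qvert r (i₂ + j₁ + (u : ℕ))).1 = (Qvert r (i₂ + j₁ + (u : ℕ))).2 := by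
  have hr := hI.rows u
  have h₂ := hI.row_le
  have hQ := Qvert_spec r (i₂ + j₁ + (u : ℕ))
  unfold extCol
  split_ifs with h h'
  · omega
  · omega
  · rw [show (Qvert r (i₂ + j₁ + (u : ℕ))).1 = i₂ + 1 by omega, hc.right]
    omega

lemma IsColData.extCol_edge (hI : IsCorner r s i₁ i₂ j₁ k m) {c : Fin m → ℤ → ℤ}
    (hc : IsColData i₁ i₂ j₁ k m c) (u : Fin m) {i : ℤ}
    (h : (Pvert s (i₁ + j₁ + k - 1 + (u : ℕ))).1 ≤ i)
    (h' : i < (Qvert r (i₂ + j₁ + (u : ℕ))).1) :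
    GEdge r s (i, extCol i₁ i₂ j₁ k c u i) (i + 1, extCol i₁ i₂ j₁ k c u (i + 1)) := by
  have hr := hI.rows u
  have hP := Pvert_spec s (i₁ + j₁ + k - 1 + (u : ℕ))
  have hQ := Qvert_spec r (i₂ + j₁ + (u : ℕ))
  obtain ⟨h₁, h₂, h₃, h₄, h₅, h₆, h₇⟩ := hI
  have hu := u.isLt
  have hl := hc.left u
  have hr' := hc.right u
  unfold GEdge extCol
  simp only [true_and]
  rcases lt_or_ge i i₁ with hi | hi
  · rw [if_pos hi]
    split_ifs with hi' hi''
    · omega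
    · omega
    · rw [show i + 1 = i₁ by omega, hl]
      omega
  rw [if_neg hi.not_gt, if_neg (show ¬ i + 1 < i₁ by omega)]
  rcases lt_or_ge (i₂ + 1) i with hi' | hi'
  · rw [if_pos hi', if_pos (by omega)]
    omega
  rw [if_neg hi'.not_gt]
  split_ifs with hi''
  · rw [show i = i₂ + 1 by omega, hr']
    omega
  · have := hc.step u i hi (by omega)
    have := hc.bounds u hi hi'
    have := hc.bounds u (i := i + 1) (by omega) (by omega)
    omega

lemma IsColData.exists_sys (hI : IsCorner r s i₁ i₂ j₁ k m) {c : Fin m → ℤ → ℤ}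
    (hc : IsColData i₁ i₂ j₁ k m c) :
    ∃ L : GSys r s (i₁ + j₁ + k - 1) (i₂ + j₁) m, L.Rep c := by
  have hrow := hI.row_le
  have hrows := hI.rows
  choose l hl hhead hlast hmem using fun u : Fin m => exists_list_of_colFun (r := r) (s := s)
    (i₁ := (Pvert s (i₁ + j₁ + k - 1 + (u : ℕ))).1) (i₂ := (Qvert r (i₂ + j₁ + (u : ℕ))).1)
    (c := extCol i₁ i₂ j₁ k c u) ((Qvert r (i₂ + j₁ + (u : ℕ))).1 -
      (Pvert s (i₁ + j₁ + k - 1 + (u : ℕ))).1).toNat (by have := hrows u; omega)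
    (fun i h h' => hc.extCol_edge hI u h h') (by have := hrows u; omega)
  refine ⟨⟨1, l, hl, fun u => ?_, fun u => ?_, fun u u' hne v hv hv' => ?_⟩, rfl, hmem⟩
  · rw [hhead, hc.extCol_source hI]
  · rw [hlast, hc.extCol_sink hI]
    rfl
  · have heq := ((hmem u v).1 hv).2.symm.trans ((hmem u' v).1 hv').2
    have hne' : (u : ℕ) ≠ u' := fun h => hne (Fin.ext h)
    unfold extCol at heq
    split_ifs at heq with h₁ h₂
    · omega
    · omega
    · rcases lt_or_gt_of_ne hne with hlt | hlt
      · have := hc.strict _ _ hlt v.1 (by omega) (by omega)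
        omega
      · have := hc.strict _ _ hlt v.1 (by omega) (by omega)
        omega

lemma extCol_of_mem {c : Fin m → ℤ → ℤ} (u : Fin m) {i : ℤ} (h : i₁ ≤ i) (h' : i ≤ i₂ + 1) :
    extCol i₁ i₂ j₁ k c u i = c u i := by
  rw [extCol, if_neg h.not_gt, if_neg h'.not_gt]

lemma extCol_congr {c c' : Fin m → ℤ → ℤ} (u : Fin m) (i : ℤ)
    (h : i₁ ≤ i → i ≤ i₂ + 1 → c u i = c' u i) :
    extCol i₁ i₂ j₁ k c u i = extCol i₁ i₂ j₁ k c' u i := by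
  unfold extCol
  split_ifs with h₁ h₂
  · rfl
  · rfl
  · exact h (not_lt.1 h₁) (not_lt.1 h₂)

lemma GSys.Rep.sys_unique {L L' : GSys r s (i₁ + j₁ + k - 1) (i₂ + j₁) m} {c c' : Fin m → ℤ → ℤ}
    (h : L.Rep c) (h' : L'.Rep c') (hcc' : ∀ u i, i₁ ≤ i → i ≤ i₂ + 1 → c u i = c' u i) : L = L' :=
  GSys.ext_path (h.1.trans h'.1.symm) (funext fun u => eq_of_chain_of_mem_iff Prod.fst
    (fun _ _ h => h.lt) (L.chain u) (L'.chain u) fun v => by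
      rw [h.2, h'.2, extCol_congr u _ (hcc' u v.1)])

lemma GSys.Rep.col_unique (hI : IsCorner r s i₁ i₂ j₁ k m)
    {L : GSys r s (i₁ + j₁ + k - 1) (i₂ + j₁) m} {c c' : Fin m → ℤ → ℤ}
    (h : L.Rep c) (h' : L.Rep c') (u : Fin m) {i : ℤ} (h₁ : i₁ ≤ i) (h₂ : i ≤ i₂ + 1) :
    c u i = c' u i := by
  have hr := hI.rows u
  have hmem := (h.2 u (i, c u i)).2 ⟨⟨by simp only; omega, by simp only; omega⟩,
    (extCol_of_mem u h₁ h₂).symm⟩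
  exact ((h'.2 u _).1 hmem).2.trans (extCol_of_mem u h₁ h₂)

lemma GSys.Rep.weight (hI : IsCorner r s i₁ i₂ j₁ k m)
    {L : GSys r s (i₁ + j₁ + k - 1) (i₂ + j₁) m} {c : Fin m → ℤ → ℤ}
    (hc : IsColData i₁ i₂ j₁ k m c) (h : L.Rep c) (x : ℤ × ℤ → ℝ) : GSysWeight x L =
      ∏ i ∈ Finset.Icc i₁ i₂, ∏ u, if c u (i + 1) = c u i then (x (i, c u i))⁻¹ else 1 := by
  rw [Finset.prod_comm]
  refine Finset.prod_congr rfl fun u _ => ?_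
  have hr := hI.rows u
  have hfirst := L.first u
  have hfinal := L.final u
  rw [h.1, Equiv.Perm.one_apply] at hfinal
  rw [listWt_of_colFun (c := extCol i₁ i₂ j₁ k c u)
    (i₁ := (Pvert s (i₁ + j₁ + k - 1 + (u : ℕ))).1) (i₂ := (Qvert r (i₂ + j₁ + (u : ℕ))).1)
    x (L.path u) (L.chain u) (by rw [hc.extCol_source hI]; exact hfirst)
    (by rw [hc.extCol_sink hI]; exact hfinal) (fun v hv => ((h.2 u v).1 hv).2)]
  symm
  have hsub : Finset.Icc i₁ i₂ ⊆ Finset.Ico (Pvert s (i₁ + j₁ + k - 1 + (u : ℕ))).1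
      (Qvert r (i₂ + j₁ + (u : ℕ))).1 := fun i hi => by
    rw [Finset.mem_Icc] at hi
    rw [Finset.mem_Ico]
    omega
  rw [← Finset.prod_subset hsub]
  · refine Finset.prod_congr rfl fun i hi => ?_
    rw [Finset.mem_Icc] at hi
    rw [extCol_of_mem u (by omega) (by omega), extCol_of_mem u (by omega) (by omega)]
  · intro i hi hi'
    rw [Finset.mem_Ico] at hi
    rw [Finset.mem_Icc] at hi'
    have hl := hc.left u
    have hr' := hc.right u
    have hrow := hI.row_le
    refine if_neg ?_
    rcases lt_or_ge i i₁ with hlt | hge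
    · rcases (show i + 1 < i₁ ∨ i + 1 = i₁ by omega) with hlt' | heq
      · rw [extCol, extCol, if_pos hlt', if_pos hlt]
        omega
      · rw [heq, extCol_of_mem u le_rfl (by omega), hl, extCol, if_pos hlt]
        omega
    · rcases (show i₂ + 1 < i ∨ i = i₂ + 1 by omega) with hgt | rfl
      · rw [extCol, extCol, if_neg (show ¬ i + 1 < i₁ by omega),
          if_pos (show i₂ + 1 < i + 1 by omega), if_neg hge.not_gt, if_pos hgt]
        omega
      · rw [extCol_of_mem (i := i₂ + 1) u (by omega) le_rfl, hr', extCol, if_neg (by omega),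
          if_pos (by omega)]
        omega

theorem finsum_GSysWeight (hI : IsCorner r s i₁ i₂ j₁ k m) (x : ℤ × ℤ → ℝ)
    (hx : ∀ p, inR r s p → 0 < x p) :
    ∑ᶠ L : GSys r s (i₁ + j₁ + k - 1) (i₂ + j₁) m, GSysWeight x L =
      (∑ᶠ L : RSys i₁ i₂ j₁ (j₁ + k + m - 1) k, RSysWeight x L) /
        wProd i₁ i₂ j₁ (j₁ + k + m - 1) x := by
  have hrow := hI.row_le
  choose a ha hLa using fun L : RSys i₁ i₂ j₁ (j₁ + k + m - 1) k => L.exists_rep (m := m)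
  choose c hc hac using fun L => (ha L).exists_conj hrow
  choose G hG using fun L => (hc L).exists_sys hI
  have hbij : Function.Bijective G := by
    constructor
    · intro L L' h
      have hcc : ∀ u i, i₁ ≤ i → i ≤ i₂ + 1 → c L u i = c L' u i := fun u i h₁ h₂ =>
        (hG L).col_unique hI (h ▸ hG L') u h₁ h₂
      have hconj : Conj i₁ i₂ j₁ (a L') (c L) := fun i h₁ h₂ t u => by
        rw [hcc u i h₁ h₂]
        exact hac L' i h₁ h₂ t u
      exact (hLa L).sys_unique (hLa L') fun t i h₁ h₂ =>
        (hac L).left_unique (ha L) (ha L') hconj t h₁ h₂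
    · intro K
      obtain ⟨d, hd, hKd⟩ := K.exists_rep hI
      obtain ⟨b, hb, hbd⟩ := hd.exists_conj hrow
      obtain ⟨L, hL⟩ := hb.exists_sys hrow
      refine ⟨L, (hG L).sys_unique hKd fun u i h₁ h₂ => ?_⟩
      refine Conj.right_unique (a := b) (hc L) hd (fun i h₁ h₂ t u => ?_) hbd u h₁ h₂
      rw [hL.row_unique hb (ha L) (hLa L) t h₁ h₂]
      exact hac L i h₁ h₂ t u
  rw [div_eq_inv_mul, ← smul_eq_mul, smul_finsum]
  symm
  refine finsum_eq_of_bijective G hbij fun L => ?_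
  rw [smul_eq_mul, ← div_eq_inv_mul, (hLa L).weight, (hG L).weight hI (hc L), wProd,
    Finset.prod_product, ← Finset.prod_div_distrib]
  refine Finset.prod_congr rfl fun i hi => ?_
  rw [Finset.mem_Icc] at hi
  have hIco : Finset.Icc j₁ (j₁ + k + m - 1) = Finset.Ico j₁ (j₁ + k + m) := by
    ext j
    rw [Finset.mem_Icc, Finset.mem_Ico]
    omega
  rw [hIco]
  refine ((hac L).prod_row (ha L) (hc L) hi.1 hi.2 (fun j => x (i, j)) fun j hj => ?_).symm
  rw [Finset.mem_Ico] at hj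
  obtain ⟨h₁, h₂, h₃, h₄, h₅, h₆, h₇⟩ := hI
  exact (hx (i, j) ⟨by simp only; omega, by simp only; omega, by simp only; omega,
    by simp only; omega⟩).ne'

lemma w_eq_finsum (i₁ i₂ j₁ j₂ : ℤ) (k : ℕ) (x : ℤ × ℤ → ℝ) :
    w i₁ i₂ j₁ j₂ k x = ∑ᶠ L : RSys i₁ i₂ j₁ j₂ k, RSysWeight x L := by
  rcases Nat.eq_zero_or_pos k with rfl | hk
  · let : Unique (RSys i₁ i₂ j₁ j₂ 0) :=
      { default := ⟨fun _ => [], fun t => t.elim0, fun t => t.elim0, fun t => t.elim0,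
          fun t => t.elim0, fun t => t.elim0⟩
        uniq := fun L => RSys.ext_path (Subsingleton.elim _ _) }
    rw [finsum_unique]
    simp [w, RSysWeight]
  · rw [w, if_neg (by omega), Int.toNat_natCast]

lemma W_eq_finsum {i j : ℤ} (x : ℤ × ℤ → ℝ) (hi : 1 ≤ i) (hj : 1 ≤ j)
    (hi' : i + m - 1 ≤ (r : ℤ) + s) (hj' : j + m - 1 ≤ (r : ℤ) + s) :
    W r s x i j m = ∑ᶠ L : GSys r s i j m, GSysWeight x L := by
  rcases Nat.eq_zero_or_pos m with rfl | hm
  · let : Unique (GSys r s i j 0) :=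
      { default := ⟨1, fun _ => [], fun t => t.elim0, fun t => t.elim0, fun t => t.elim0,
          fun t => t.elim0⟩
        uniq := fun L => GSys.ext_path (Subsingleton.elim _ _) (Subsingleton.elim _ _) }
    rw [finsum_unique]
    simp [W, GSysWeight]
  · rw [W, if_neg (by omega), if_neg (by omega), if_pos ⟨hi, hj, hi', hj'⟩, Int.toNat_natCast]

end Systems

/-- **Corollary 3.4(a).** For an interval `I = [i₁,i₂] × [j₁,j₂]` of `R = [r] × [s]`
with (`i₁ = 1` or `j₂ = s`) and (`j₁ = 1` or `i₂ = r`), and `0 ≤ k ≤ j₂ - j₁ + 1`,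
`W_{i₁+j₁+k-1, i₂+j₁}^{(j₂-j₁-k+1)}(x) = w_I^{(k)}(x) / w_I(x)`. -/
theorem W_eq_w_div_wProd (r s : ℕ) (hr : 1 ≤ r) (hs : 1 ≤ s) (x : ℤ × ℤ → ℝ)
    (hx : ∀ p, inR r s p → 0 < x p) (i₁ i₂ j₁ j₂ : ℤ)
    (h1 : 1 ≤ i₁) (h2 : i₁ ≤ i₂) (h3 : i₂ ≤ (r : ℤ))
    (h4 : 1 ≤ j₁) (h5 : j₁ ≤ j₂) (h6 : j₂ ≤ (s : ℤ))
    (hI : i₁ = 1 ∨ j₂ = (s : ℤ)) (hI' : j₁ = 1 ∨ i₂ = (r : ℤ))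
    (k : ℤ) (hk0 : 0 ≤ k) (hk : k ≤ j₂ - j₁ + 1) :
    W r s x (i₁ + j₁ + k - 1) (i₂ + j₁) (j₂ - j₁ - k + 1)
      = w i₁ i₂ j₁ j₂ k x / wProd i₁ i₂ j₁ j₂ x := by
  lift k to ℕ using hk0
  obtain ⟨m, hm⟩ : ∃ m : ℕ, j₂ = j₁ + k + m - 1 := ⟨(j₂ - j₁ - k + 1).toNat, by omega⟩
  subst hm
  rw [show j₁ + k + m - 1 - j₁ - k + 1 = (m : ℤ) by ring, w_eq_finsum,
    W_eq_finsum x (by omega) (by omega) (by omega) (by omega)]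
  exact finsum_GSysWeight ⟨h1, h2, h3, h4, h6, hI, hI'⟩ x hx

end Paper
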